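/- Let n be any natural number. If (σ, τ) is a table automorphism of the alternating group A_n, then τ preserves element orders: for every g ∈ A_n and every h ∈ A_n whose conjugacy class equals τ(conjugacy class of g), the order of h equals the order of g. -/

import Mathlib

/-- `f : G → ℂ` is an irreducible character of `G` if it is the character of some
irreducible (simple) finite-dimensional complex representation of `G`. -/
def IsIrrChar (G : Type) [Group G] (f : G → ℂ) : Prop :=
  ∃ V : FDRep ℂ G, CategoryTheory.Simple V ∧ f = V.character

/-- `(σ, τ)` is a table automorphism of `G`: `σ` permutes the irreducible characters,
`τ` permutes the conjugacy classes, and for every irreducible character `f`, every `g`,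
and every `h` whose conjugacy class is `τ` of the class of `g`, `(σ f) h = f g`. -/
def IsTableAut (G : Type) [Group G]
    (σ : Equiv.Perm {f : G → ℂ // IsIrrChar G f})
    (τ : Equiv.Perm (ConjClasses G)) : Prop :=
  ∀ (f : {f : G → ℂ // IsIrrChar G f}) (g h : G),
    ConjClasses.mk h = τ (ConjClasses.mk g) → (σ f).1 h = f.1 g

section CharacterTheory

open CategoryTheory

variable {G : Type} [Group G] [Fintype G]

/-- A class-function-weighted sum of the operators of a simple representation is a scalar. -/
lemma FDRep.exists_sum_smul_rho_eq (V : FDRep ℂ G) [Simple V] (f : G → ℂ)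
    (hf : ∀ x y, f (y * x * y⁻¹) = f x) :
    ∃ c : ℂ, ∑ x, f x • V.ρ x = c • (1 : V →ₗ[ℂ] V) := by
  have hcomm : ∀ y, (∑ x, f x • V.ρ x) * V.ρ y = V.ρ y * (∑ x, f x • V.ρ x) := by
    intro y
    rw [Finset.sum_mul, Finset.mul_sum]
    refine Fintype.sum_equiv (MulAut.conj y⁻¹).toEquiv _ _ fun x => ?_
    have h1 : f ((MulAut.conj y⁻¹).toEquiv x) = f x := by
      simpa using hf x y⁻¹
    rw [h1, smul_mul_assoc, mul_smul_comm, ← map_mul, ← map_mul]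
    simp [mul_assoc]
  let φ : V ⟶ V :=
    { hom := FGModuleCat.ofHom (∑ x, f x • V.ρ x)
      comm := fun y => by
        ext v
        exact LinearMap.congr_fun (hcomm y) v }
  obtain ⟨c, hc⟩ := endomorphism_simple_eq_smul_id ℂ φ
  refine ⟨c, ?_⟩
  ext v
  have := congrArg (fun ψ : V ⟶ V => ψ.hom.hom.hom v) hc
  exact this.symm

lemma FDRep.sum_mul_character_mul (V : FDRep ℂ G) [Simple V] (f : G → ℂ)
    (hf : ∀ x y, f (y * x * y⁻¹) = f x) (z : G) :
    (∑ x, f x * V.character (x * z)) * V.character 1 =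
      (∑ x, f x * V.character x) * V.character z := by
  obtain ⟨c, hc⟩ := V.exists_sum_smul_rho_eq f hf
  have key : ∀ z, ∑ x, f x * V.character (x * z) = c * V.character z := by
    intro z
    have := congrArg (fun L : V →ₗ[ℂ] V => LinearMap.trace ℂ V (L * V.ρ z)) hc
    simpa [Finset.sum_mul, FDRep.character, map_sum, smul_mul_assoc] using this
  have h1 := key 1
  simp only [mul_one] at h1
  rw [key, h1]
  ring

lemma Representation.IsIrreducible.simple_fdRepOf {V : Type} [AddCommGroup V] [Module ℂ V]
    [Module.Finite ℂ V] (ρ : Representation ℂ G V) [ρ.IsIrreducible] :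
    Simple (FDRep.of ρ) := by
  have := invertibleOfNonzero (NeZero.ne (Nat.card G : ℂ))
  rw [FDRep.simple_iff_char_is_norm_one]
  have h := Representation.char_orthonormal ρ ρ
  rw [if_pos ⟨Representation.Equiv.refl ρ⟩, inv_mul_eq_one₀ (NeZero.ne _)] at h
  exact h.symm

/-- A class function orthogonal to all irreducible characters acts as zero on simple modules. -/
lemma sum_single_smul_eq_zero_of_isSimpleModule (f : G → ℂ)
    (hf : ∀ x y, f (y * x * y⁻¹) = f x)
    (h : ∀ ψ, IsIrrChar G ψ → ∑ x, f x * ψ x = 0)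
    (M : Type) [AddCommGroup M] [Module ℂ M] [Module (MonoidAlgebra ℂ G) M]
    [IsScalarTower ℂ (MonoidAlgebra ℂ G) M] [IsSimpleModule (MonoidAlgebra ℂ G) M] (m : M) :
    (∑ x, MonoidAlgebra.single x (f x) : MonoidAlgebra ℂ G) • m = 0 := by
  let ρ : Representation ℂ G M := Representation.ofModule' M
  have hρ : ∀ r : MonoidAlgebra ℂ G, ρ.asAlgebraHom r = Algebra.lsmul ℂ ℂ M r := by
    intro r
    exact DFunLike.congr_fun ((MonoidAlgebra.lift ℂ (M →ₗ[ℂ] M) G).apply_symm_apply _) r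
  have : IsSimpleModule (MonoidAlgebra ℂ G) ρ.asModule := by
    let e : ρ.asModule ≃ₗ[MonoidAlgebra ℂ G] M :=
      { ρ.asModuleEquiv with
        map_smul' := fun r v => by
          have := ρ.asModuleEquiv_map_smul r v
          rw [hρ] at this
          exact this }
    exact IsSimpleModule.congr e
  have : ρ.IsIrreducible := (Representation.irreducible_iff_isSimpleModule_asModule ρ).mpr this
  have : Module.Finite ℂ M := Module.Finite.trans (MonoidAlgebra ℂ G) _
  have : Simple (FDRep.of ρ) := Representation.IsIrreducible.simple_fdRepOf ρ
  obtain ⟨c, hc⟩ := (FDRep.of ρ).exists_sum_smul_rho_eq f hf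
  have h0 := h _ ⟨FDRep.of ρ, inferInstance, rfl⟩
  have hc' : c = 0 := by
    have h1 := congrArg (LinearMap.trace ℂ _) hc
    simp only [map_sum, map_smul, smul_eq_mul, LinearMap.trace_one] at h1
    rw [show ∑ x, f x * LinearMap.trace ℂ _ ((FDRep.of ρ).ρ x) = 0 from h0] at h1
    have : Nontrivial M := IsSimpleModule.nontrivial (MonoidAlgebra ℂ G) M
    have : Nontrivial (FDRep.of ρ) := inferInstanceAs (Nontrivial M)
    have := Module.finrank_pos (R := ℂ) (M := FDRep.of ρ)
    have h2 : (Module.finrank ℂ (FDRep.of ρ) : ℂ) ≠ 0 := by exact_mod_cast this.ne'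
    exact (mul_eq_zero.mp h1.symm).resolve_right h2
  rw [hc', zero_smul] at hc
  have h3 : ρ.asAlgebraHom (∑ x, MonoidAlgebra.single x (f x)) = 0 := by
    refine Eq.trans ?_ hc
    rw [map_sum]
    exact Finset.sum_congr rfl fun x _ => by
      rw [Representation.asAlgebraHom_single]; rfl
  rw [hρ] at h3
  exact LinearMap.congr_fun h3 m

lemma eq_zero_of_forall_sum_mul_irrChar_eq_zero (f : G → ℂ)
    (hf : ∀ x y, f (y * x * y⁻¹) = f x)
    (h : ∀ ψ, IsIrrChar G ψ → ∑ x, f x * ψ x = 0) : f = 0 := by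
  let e : MonoidAlgebra ℂ G := ∑ x, MonoidAlgebra.single x (f x)
  have he : e ∈ Ring.jacobson (MonoidAlgebra ℂ G) := by
    rw [Ring.jacobson, Module.jacobson, Submodule.mem_sInf]
    intro I hI
    have : IsSimpleModule (MonoidAlgebra ℂ G) (MonoidAlgebra ℂ G ⧸ I) :=
      isSimpleModule_iff_isCoatom.mpr hI
    have h5 := sum_single_smul_eq_zero_of_isSimpleModule f hf h (MonoidAlgebra ℂ G ⧸ I)
      (Submodule.Quotient.mk 1)
    rw [← Submodule.Quotient.mk_smul, smul_eq_mul, mul_one] at h5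
    exact (Submodule.Quotient.mk_eq_zero I).mp h5
  rw [IsSemisimpleRing.jacobson_eq_bot, Submodule.mem_bot] at he
  funext x
  have h1 : e.coeff x = 0 := by rw [he]; rfl
  classical
  simpa [e, MonoidAlgebra.coeff_sum, Finsupp.single_apply] using h1

end CharacterTheory

section TableAutomorphism

open CategoryTheory

variable {G : Type} [Group G]

lemma IsIrrChar.conj {ψ : G → ℂ} (h : IsIrrChar G ψ) (x y : G) : ψ (y * x * y⁻¹) = ψ x := by
  obtain ⟨V, -, rfl⟩ := h
  exact V.char_conj x y

lemma IsIrrChar.exists_pos_apply_one [Fintype G] {ψ : G → ℂ} (h : IsIrrChar G ψ) :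
    ∃ d : ℕ, 0 < d ∧ ψ 1 = d := by
  obtain ⟨V, hV, rfl⟩ := h
  refine ⟨Module.finrank ℂ V, ?_, V.char_one⟩
  refine Nat.pos_of_ne_zero fun h0 => ?_
  have h1 := (FDRep.simple_iff_char_is_norm_one (V := V)).mp hV
  have : ∀ g, V.ρ g = 0 := fun g => by
    have := Module.finrank_zero_iff.mp h0
    exact LinearMap.ext fun v => Subsingleton.elim _ _
  simp only [FDRep.character, this, map_zero, mul_zero, Finset.sum_const_zero] at h1
  exact Nat.card_pos.ne' (Nat.cast_eq_zero.mp h1.symm)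

variable (G) in
/-- The trivial one-dimensional representation. -/
noncomputable def trivialFDRep : FDRep ℂ G := FDRep.of (Representation.trivial ℂ G ℂ)

lemma trivialFDRep_character : (trivialFDRep G).character = fun _ => 1 := by
  ext g
  have : (trivialFDRep G).ρ g = 1 := rfl
  rw [FDRep.character, this, LinearMap.trace_one]
  have : Module.finrank ℂ (trivialFDRep G) = 1 := Module.finrank_self ℂ
  rw [this, Nat.cast_one]

instance [Fintype G] : Simple (trivialFDRep G) := by
  rw [FDRep.simple_iff_char_is_norm_one, trivialFDRep_character]
  simp

lemma isIrrChar_one [Fintype G] : IsIrrChar G (fun _ => 1) :=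
  ⟨trivialFDRep G, inferInstance, trivialFDRep_character.symm⟩

lemma IsIrrChar.sum_eq_zero [Fintype G] {ψ : G → ℂ} (h : IsIrrChar G ψ) (h1 : ψ ≠ fun _ => 1) :
    ∑ x, ψ x = 0 := by
  obtain ⟨V, hV, rfl⟩ := h
  have := invertibleOfNonzero (NeZero.ne (Nat.card G : ℂ))
  have h2 := FDRep.char_orthonormal V (trivialFDRep G)
  rw [if_neg fun ⟨e⟩ => h1 ((FDRep.char_iso e).trans trivialFDRep_character),
    trivialFDRep_character] at h2
  simpa using h2

/-- Class functions are spanned by the irreducible characters. -/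
lemma mem_span_irrChar [Fintype G] (F : G → ℂ) (hF : ∀ x y, F (y * x * y⁻¹) = F x) :
    F ∈ Submodule.span ℂ (Set.range (Subtype.val : {f : G → ℂ // IsIrrChar G f} → G → ℂ)) := by
  classical
  by_contra hFS
  obtain ⟨φ, hφ, hS⟩ := Submodule.exists_le_ker_of_notMem hFS
  have hφw : ∀ u, φ u = ∑ x, φ (Pi.single x 1) * u x := by
    intro u
    conv_lhs => rw [← Finset.univ_sum_single u]
    rw [map_sum]
    refine Finset.sum_congr rfl fun x _ => ?_
    have : (Pi.single x (u x) : G → ℂ) = u x • Pi.single x 1 := by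
      ext y; by_cases h : y = x
      · subst h; simp
      · simp [h]
    rw [this, map_smul, smul_eq_mul, mul_comm]
  have hav : ∀ u : G → ℂ, (∀ x y, u (y * x * y⁻¹) = u x) →
      ∑ x, (∑ y, φ (Pi.single (y * x * y⁻¹) 1)) * u x = Fintype.card G * φ u := by
    intro u hu
    simp_rw [Finset.sum_mul]
    rw [Finset.sum_comm]
    have : ∀ y, ∑ x, φ (Pi.single (y * x * y⁻¹) 1) * u x = φ u := by
      intro y
      rw [hφw u]
      refine Fintype.sum_equiv (MulAut.conj y).toEquiv _ _ fun x => ?_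
      simp [hu]
    simp [this]
  have h0 : (fun x => ∑ y, φ (Pi.single (y * x * y⁻¹) 1)) = 0 := by
    refine eq_zero_of_forall_sum_mul_irrChar_eq_zero _ (fun x z => ?_) fun ψ hψ => ?_
    · refine Fintype.sum_equiv (Equiv.mulRight z) _ _ fun y => ?_
      simp [mul_assoc]
    · rw [hav ψ hψ.conj]
      have : φ ψ = 0 := hS (Submodule.subset_span ⟨⟨ψ, hψ⟩, rfl⟩)
      rw [this, mul_zero]
  have h2 := hav F hF
  simp only [funext_iff, Pi.zero_apply] at h0
  simp only [h0, zero_mul, Finset.sum_const_zero] at h2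
  have : (Fintype.card G : ℂ) ≠ 0 := by exact_mod_cast Fintype.card_ne_zero
  exact hφ ((mul_eq_zero.mp h2.symm).resolve_left this)

namespace IsTableAut

variable {σ : Equiv.Perm {f : G → ℂ // IsIrrChar G f}} {τ : Equiv.Perm (ConjClasses G)}

lemma symm (hT : IsTableAut G σ τ) : IsTableAut G σ.symm τ.symm := by
  intro f g h hgh
  have := hT (σ.symm f) h g (by rw [hgh, Equiv.apply_symm_apply])
  rw [Equiv.apply_symm_apply] at this
  exact this.symm

variable [Fintype G]

/-- Functionals on class functions matching on irreducible characters match on class functions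
matched by the automorphism. -/
lemma functional_eq (hT : IsTableAut G σ τ) (L L' : (G → ℂ) →ₗ[ℂ] ℂ)
    (hL : ∀ ψ, L' (σ ψ).1 = L ψ.1) {F F' : G → ℂ} (hF : ∀ x y, F (y * x * y⁻¹) = F x)
    (hFF : ∀ g h, ConjClasses.mk h = τ (ConjClasses.mk g) → F' h = F g) : L' F' = L F := by
  obtain ⟨a, ha⟩ := (Finsupp.mem_span_range_iff_exists_finsupp).mp (mem_span_irrChar F hF)
  have hF' : F' = a.sum fun ψ c => c • (σ ψ).1 := by
    ext h
    obtain ⟨g, hg⟩ := ConjClasses.mk_surjective (τ.symm (ConjClasses.mk h))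
    have hgh : ConjClasses.mk h = τ (ConjClasses.mk g) := by rw [hg, Equiv.apply_symm_apply]
    rw [hFF g h hgh, ← ha]
    simp only [Finsupp.sum, Finset.sum_apply, Pi.smul_apply, smul_eq_mul]
    exact Finset.sum_congr rfl fun ψ _ => by rw [hT ψ g h hgh]
  rw [hF', ← ha]
  simp only [Finsupp.sum, map_sum, map_smul, hL]

lemma apply_one (hT : IsTableAut G σ τ) : (σ ⟨_, isIrrChar_one⟩).1 = fun _ => 1 := by
  ext h
  obtain ⟨g, hg⟩ := ConjClasses.mk_surjective (τ.symm (ConjClasses.mk h))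
  exact hT ⟨_, isIrrChar_one⟩ g h (by rw [hg, Equiv.apply_symm_apply])

lemma sum_eq (hT : IsTableAut G σ τ) {F F' : G → ℂ} (hF : ∀ x y, F (y * x * y⁻¹) = F x)
    (hFF : ∀ g h, ConjClasses.mk h = τ (ConjClasses.mk g) → F' h = F g) :
    ∑ x, F' x = ∑ x, F x := by
  let L : (G → ℂ) →ₗ[ℂ] ℂ := ∑ x, LinearMap.proj x
  have hLa : ∀ F, L F = ∑ x, F x := fun F => by simp [L]
  rw [← hLa, ← hLa]
  refine hT.functional_eq L L (fun ψ => ?_) hF hFF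
  rw [hLa, hLa]
  by_cases h1 : ψ.1 = fun _ => 1
  · have : ψ = ⟨_, isIrrChar_one⟩ := Subtype.ext h1
    rw [this, hT.apply_one]
  · rw [ψ.2.sum_eq_zero h1, (σ ψ).2.sum_eq_zero]
    intro h2
    apply h1
    have : σ ψ = σ ⟨_, isIrrChar_one⟩ := Subtype.ext (h2.trans hT.apply_one.symm)
    rw [σ.injective this]

/-- A table automorphism preserves the sizes of conjugacy classes. -/
lemma card_class_eq (hT : IsTableAut G σ τ) (C : ConjClasses G) :
    Nat.card {x // ConjClasses.mk x = τ C} = Nat.card {x // ConjClasses.mk x = C} := by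
  classical
  have := hT.sum_eq (F := fun x => if ConjClasses.mk x = C then 1 else 0)
    (F' := fun x => if ConjClasses.mk x = τ C then 1 else 0) (fun x y => by
      have : ConjClasses.mk (y * x * y⁻¹) = ConjClasses.mk x :=
        ConjClasses.mk_eq_mk_iff_isConj.mpr (isConj_iff.mpr ⟨y⁻¹, by group⟩)
      simp only [this]) (fun g h hgh => by simp only [hgh, τ.injective.eq_iff])
  simp only [Finset.sum_boole] at this
  rw [Nat.card_eq_fintype_card, Nat.card_eq_fintype_card, Fintype.card_subtype,
    Fintype.card_subtype]
  exact_mod_cast this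

lemma map_one (hT : IsTableAut G σ τ) : τ (ConjClasses.mk 1) = ConjClasses.mk 1 := by
  classical
  obtain ⟨h, hh⟩ := ConjClasses.mk_surjective (τ (ConjClasses.mk 1))
  have hcard := hT.card_class_eq (ConjClasses.mk 1)
  have h1 : Nat.card {x : G // ConjClasses.mk x = ConjClasses.mk 1} = 1 := by
    rw [Nat.card_eq_one_iff_unique]
    refine ⟨⟨fun x y => Subtype.ext ?_⟩, ⟨⟨1, rfl⟩⟩⟩
    have hx := isConj_one_right.mp (ConjClasses.mk_eq_mk_iff_isConj.mp x.2).symm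
    have hy := isConj_one_right.mp (ConjClasses.mk_eq_mk_iff_isConj.mp y.2).symm
    rw [hx, hy]
  rw [h1, ← hh, Nat.card_eq_one_iff_unique] at hcard
  have hcent : ∀ y, y * h * y⁻¹ = h := by
    intro y
    have := hcard.1
    exact congrArg Subtype.val (Subsingleton.elim
      (⟨y * h * y⁻¹, ConjClasses.mk_eq_mk_iff_isConj.mpr (isConj_iff.mpr ⟨y⁻¹, by group⟩)⟩ :
        {x // ConjClasses.mk x = ConjClasses.mk h}) ⟨h, rfl⟩)
  have key : ∀ ψ : G → ℂ, IsIrrChar G ψ → ψ h = ψ 1 := by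
    intro ψ hψ
    obtain ⟨d, hd, hd1⟩ := hψ.exists_pos_apply_one
    obtain ⟨d', hd', hd1'⟩ := (σ.symm ⟨ψ, hψ⟩).2.exists_pos_apply_one
    have hψh : ψ h = d' := by
      have := hT (σ.symm ⟨ψ, hψ⟩) 1 h hh
      rw [Equiv.apply_symm_apply, hd1'] at this
      exact this
    have hdne : (d : ℂ) ≠ 0 := by exact_mod_cast hd.ne'
    have hmul : ∀ z, ψ (h * z) * d = d' * ψ z := by
      intro z
      obtain ⟨V, hV, rfl⟩ := hψ
      have := V.sum_mul_character_mul (fun x => if x = h then 1 else 0) (fun x y => by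
        have : y * x * y⁻¹ = h ↔ x = h := by
          constructor
          · intro hx
            have := hcent y⁻¹
            rw [← hx] at this
            rw [← hcent y⁻¹, ← hx]; group
          · rintro rfl; exact hcent y
        simp only [this]) z
      simpa [hd1, hψh] using this
    have hpow : ∀ k : ℕ, ψ (h ^ k) * (d : ℂ) ^ k = (d' : ℂ) ^ k * d := by
      intro k
      induction k with
      | zero => simp [hd1]
      | succ k ih =>
        rw [pow_succ', pow_succ', ← mul_assoc, hmul, mul_assoc, ih]; ring
    have h2 := hpow (orderOf h)
    rw [pow_orderOf_eq_one, hd1, mul_comm] at h2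
    have h3 := mul_right_cancel₀ hdne h2
    have h4 : d ^ orderOf h = d' ^ orderOf h := by exact_mod_cast h3
    have h5 := Nat.pow_left_injective (orderOf_pos h).ne' h4
    rw [hψh, hd1, h5]
  have hspan : ∀ u ∈ Submodule.span ℂ
      (Set.range (Subtype.val : {f : G → ℂ // IsIrrChar G f} → G → ℂ)), u h = u 1 := by
    intro u hu
    induction hu using Submodule.span_induction with
    | mem u hu => obtain ⟨ψ, rfl⟩ := hu; exact key _ ψ.2
    | zero => rfl
    | add u v _ _ hu hv => simp [hu, hv]
    | smul c u _ hu => simp [hu]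
  have := hspan _ (mem_span_irrChar (fun x => if x = 1 then 1 else 0) fun x y => by
    simp [conj_eq_one_iff])
  have hh1 : h = 1 := by
    by_contra hne
    simp [hne] at this
  rw [← hh, hh1]

lemma apply_one_eq (hT : IsTableAut G σ τ) (ψ) : (σ ψ).1 1 = ψ.1 1 :=
  hT ψ 1 1 hT.map_one.symm

/-- A table automorphism preserves class multiplication counts. -/
lemma sum_mul_eq (hT : IsTableAut G σ τ) {A A' B B' : G → ℂ}
    (hA : ∀ x y, A (y * x * y⁻¹) = A x) (hB : ∀ x y, B (y * x * y⁻¹) = B x)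
    (hA' : ∀ x y, A' (y * x * y⁻¹) = A' x)
    (hAA : ∀ g h, ConjClasses.mk h = τ (ConjClasses.mk g) → A' h = A g)
    (hBB : ∀ g h, ConjClasses.mk h = τ (ConjClasses.mk g) → B' h = B g)
    {g h : G} (hgh : ConjClasses.mk h = τ (ConjClasses.mk g)) :
    ∑ x, A' x * B' (x * h) = ∑ x, A x * B (x * g) := by
  let L (A : G → ℂ) (g : G) : (G → ℂ) →ₗ[ℂ] ℂ := ∑ x, A x • LinearMap.proj (x * g)
  have hLa : ∀ A g F, L A g F = ∑ x, A x * F (x * g) := fun A g F => by simp [L]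
  rw [← hLa, ← hLa]
  refine hT.functional_eq _ _ (fun ψ => ?_) hB hBB
  rw [hLa, hLa]
  have hψ1 : ψ.1 1 ≠ 0 := by
    obtain ⟨d, hd, hd1⟩ := ψ.2.exists_pos_apply_one
    rw [hd1]; exact_mod_cast hd.ne'
  have e1 : (∑ x, A x * ψ.1 (x * g)) * ψ.1 1 = (∑ x, A x * ψ.1 x) * ψ.1 g := by
    obtain ⟨V, hV, h⟩ := ψ.2
    rw [h]; exact V.sum_mul_character_mul A hA g
  have e2 : (∑ x, A' x * (σ ψ).1 (x * h)) * (σ ψ).1 1 =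
      (∑ x, A' x * (σ ψ).1 x) * (σ ψ).1 h := by
    obtain ⟨V, hV, h'⟩ := (σ ψ).2
    rw [h']; exact V.sum_mul_character_mul A' hA' h
  have e3 : ∑ x, A' x * (σ ψ).1 x = ∑ x, A x * ψ.1 x :=
    hT.sum_eq (fun x y => by rw [hA, ψ.2.conj]) fun g h hgh => by
      rw [hAA g h hgh, hT ψ g h hgh]
  rw [hT.apply_one_eq, e3, hT ψ g h hgh, ← e1] at e2
  exact mul_right_cancel₀ hψ1 e2

/-- If a table automorphism stabilizes a normal subset `T`, it matches right multiplication by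
elements of `T`. -/
lemma exists_equiv (hT : IsTableAut G σ τ) (T : Set G)
    (hTT : ∀ g h, ConjClasses.mk h = τ (ConjClasses.mk g) → (h ∈ T ↔ g ∈ T))
    (hTc : ∀ x y, y * x * y⁻¹ ∈ T ↔ x ∈ T)
    {g h : G} (hgh : ConjClasses.mk h = τ (ConjClasses.mk g)) :
    ∃ e : T ≃ T, ∀ t : T, ConjClasses.mk (h * e t) = τ (ConjClasses.mk (g * t)) := by
  classical
  have hmk : ∀ x y : G, ConjClasses.mk (y * x * y⁻¹) = ConjClasses.mk x := fun x y =>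
    ConjClasses.mk_eq_mk_iff_isConj.mpr (isConj_iff.mpr ⟨y⁻¹, by group⟩)
  have hswap : ∀ x y : G, ConjClasses.mk (x * y) = ConjClasses.mk (y * x) := fun x y => by
    rw [← hmk (x * y) y]; group
  have hcard : ∀ C, Nat.card {t : T // τ (ConjClasses.mk (g * t)) = C} =
      Nat.card {t : T // ConjClasses.mk (h * t) = C} := by
    intro C
    have := hT.sum_mul_eq (A := fun x => if x ∈ T then 1 else 0)
      (A' := fun x => if x ∈ T then 1 else 0)
      (B := fun x => if τ (ConjClasses.mk x) = C then 1 else 0)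
      (B' := fun x => if ConjClasses.mk x = C then 1 else 0)
      (fun x y => by simp only [hTc]) (fun x y => by simp only [hmk])
      (fun x y => by simp only [hTc]) (fun g h hgh => by simp only [hTT g h hgh])
      (fun g h hgh => by simp only [hgh]) hgh
    simp only [← ite_and, mul_ite, mul_one, mul_zero, Finset.sum_boole] at this
    have h2 := Nat.cast_injective this
    rw [← Fintype.card_subtype, ← Fintype.card_subtype, ← Nat.card_eq_fintype_card,
      ← Nat.card_eq_fintype_card] at h2
    have aux : ∀ p : G → Prop, Nat.card {t : T // p t} = Nat.card {x // p x ∧ x ∈ T} := fun p =>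
      Nat.card_congr ((Equiv.subtypeSubtypeEquivSubtypeInter (· ∈ T) p).trans
        (Equiv.subtypeEquivRight fun x => and_comm))
    rw [aux fun t => τ (ConjClasses.mk (g * t)) = C, aux fun t => ConjClasses.mk (h * t) = C]
    simp only [hswap g, hswap h]
    exact h2.symm
  let e (C) := (Finite.card_eq.mp (hcard C)).some
  exact ⟨Equiv.ofFiberEquiv e, Equiv.ofFiberEquiv_map e⟩

end IsTableAut

end TableAutomorphism

section ThreeCycles

open Equiv Equiv.Perm Function Finset

variable {α : Type} [Fintype α] [DecidableEq α]

/-- The number of points of minimal period `l` under `g`. -/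
noncomputable def periodCount (g : Perm α) (l : ℕ) : ℕ := #{a | minimalPeriod g a = l}

/-- Multiplying `g` on the right by a `3`-cycle `t` with this property fixes `g c`, `g (g c)`. -/
def Cancels (g : Perm α) (c : α) (t : Perm α) : Prop :=
  g c ≠ c ∧ t (g (g c)) = g c ∧ t (g c) = c

instance (g : Perm α) (c : α) (t : Perm α) : Decidable (Cancels g c t) :=
  inferInstanceAs (Decidable (_ ∧ _))

lemma Equiv.Perm.IsThreeCycle.cube_apply {t : Perm α} (ht : t.IsThreeCycle) (x : α) :
    t (t (t x)) = x := by
  have h := pow_orderOf_eq_one t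
  rw [ht.orderOf] at h
  exact congrArg (· x) h

lemma Equiv.Perm.IsThreeCycle.eq_of_apply_ne {t : Perm α} (ht : t.IsThreeCycle) {x y : α}
    (hx : t x ≠ x) (hy : t y ≠ y) : y = x ∨ y = t x ∨ y = t (t x) := by
  have h1 : t (t x) ≠ x := fun h => by
    have := ht.cube_apply x
    rw [h] at this
    exact hx this
  have hsub : ({x, t x, t (t x)} : Finset α) ⊆ t.support := by
    intro z hz
    simp only [mem_insert, Finset.mem_singleton] at hz
    rcases hz with rfl | rfl | rfl <;> simpa using hx
  have hc : #({x, t x, t (t x)} : Finset α) = 3 := by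
    rw [card_eq_three]
    exact ⟨x, t x, t (t x), hx.symm, h1.symm, fun h => hx (t.injective h).symm, rfl⟩
  have := eq_of_subset_of_card_le hsub (by rw [hc, ht.card_support])
  have hy' : y ∈ t.support := mem_support.mpr hy
  rw [← this] at hy'
  simpa using hy'

lemma card_filter_eq_add_three {x y z : α} (hxy : x ≠ y) (hxz : x ≠ z) (hyz : y ≠ z)
    (p : α → Prop) [DecidablePred p] :
    #{i | p i} = #{i | (i ≠ x ∧ i ≠ y ∧ i ≠ z) ∧ p i} +
      ((if p x then 1 else 0) + (if p y then 1 else 0) + (if p z then 1 else 0)) := by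
  have h1 : ∀ q : α → Prop, [DecidablePred q] → #{i | q i} = ∑ i, if q i then 1 else 0 :=
    fun q _ => by simp
  have h2 : ∀ w : α, (if p w then 1 else 0) = ∑ i, if i = w ∧ p i then 1 else 0 := fun w => by
    simp [ite_and]
  rw [h1, h1, h2 x, h2 y, h2 z, ← sum_add_distrib, ← sum_add_distrib, ← sum_add_distrib]
  refine sum_congr rfl fun i _ => ?_
  by_cases hx : i = x
  · subst hx; simp [hxy, hxz]
  by_cases hy : i = y
  · subst hy; simp [hx, hyz]
  by_cases hz : i = z
  · subst hz; simp [hx, hy]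
  simp [hx, hy, hz]

/-- Effect of multiplication by the `3`-cycle `t = (x y z)` on fixed points. -/
lemma card_cancels_and_card_support (g : Perm α) {t : Perm α} (ht : t.IsThreeCycle)
    {x y z : α} (hxy : x ≠ y) (hx : t x = y) (hy : t y = z) :
    #{c | Cancels g c t} = (if g y = x ∧ g x = z then 1 else 0) +
      (if g y = x ∧ g z = y then 1 else 0) + (if g z = y ∧ g x = z then 1 else 0) ∧
    ∃ r, #g.support = r +
        ((if g x ≠ x then 1 else 0) + (if g y ≠ y then 1 else 0) + (if g z ≠ z then 1 else 0)) ∧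
      #(g * t).support = r +
        ((if g y ≠ x then 1 else 0) + (if g z ≠ y then 1 else 0) + (if g x ≠ z then 1 else 0)) := by
  have hz : t z = x := by rw [← hy, ← hx]; exact ht.cube_apply x
  have hyz : y ≠ z := by rintro rfl; exact hxy (t.injective (hx.trans hy.symm))
  have hxz : x ≠ z := by rintro rfl; exact hxy (hz.symm.trans hx)
  have hfix : ∀ i, i ≠ x ∧ i ≠ y ∧ i ≠ z → t i = i := by
    intro i ⟨h1, h2, h3⟩
    by_contra h
    rcases ht.eq_of_apply_ne (hx.trans_ne hxy.symm) h with h | h | h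
    exacts [h1 h, h2 (h.trans hx), h3 (h.trans (by rw [hx, hy]))]
  constructor
  · rw [card_filter_eq_add_three hxy hxz hyz, card_eq_zero.mpr, zero_add]
    · have aux : ∀ {a b d : α}, t b = a → t d = b → a ≠ b →
          (Cancels g a t ↔ g b = d ∧ g a = b) := by
        intro a b d hb hd hab
        constructor
        · rintro ⟨-, h1, h2⟩
          have h3 := t.injective (h2.trans hb.symm)
          rw [h3] at h1
          exact ⟨t.injective (h1.trans hd.symm), h3⟩
        · rintro ⟨h1, h2⟩
          exact ⟨h2.trans_ne hab.symm, by rw [h2, h1, hd], by rw [h2, hb]⟩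
      have c1 : Cancels g x t ↔ g z = y ∧ g x = z := aux hz hy hxz
      have c2 : Cancels g y t ↔ g x = z ∧ g y = x := aux hx hz hxy.symm
      have c3 : Cancels g z t ↔ g y = x ∧ g z = y := aux hy hx hyz.symm
      simp only [c1, c2, c3, and_comm]
      omega
    · refine filter_eq_empty_iff.mpr fun i _ ⟨hi, h1, h2, h3⟩ => h1 ?_
      have := hfix i hi
      exact t.injective (h3.trans this.symm)
  · refine ⟨#{i | (i ≠ x ∧ i ≠ y ∧ i ≠ z) ∧ g i ≠ i}, ?_, ?_⟩
    · exact card_filter_eq_add_three hxy hxz hyz _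
    · refine (card_filter_eq_add_three hxy hxz hyz _).trans ?_
      congr 1
      · congr 1
        ext i
        simp only [mem_filter, mem_univ, true_and]
        exact and_congr_right fun hi => by rw [Perm.mul_apply, hfix i hi]
      · simp only [Perm.mul_apply, hx, hy, hz]

lemma card_cancels_cases (g : Perm α) {t : Perm α} (ht : t.IsThreeCycle) :
    (#{c | Cancels g c t} = 3 ∧ #(g * t).support + 3 = #g.support) ∨
    (#{c | Cancels g c t} = 1 ∧ #(g * t).support + 2 = #g.support) ∨
    (#{c | Cancels g c t} = 0 ∧ #g.support ≤ #(g * t).support + 1) := by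
  obtain ⟨x, hx⟩ : ∃ x, t x ≠ x := by
    by_contra! h
    exact ht.isCycle.ne_one (Equiv.ext h)
  obtain ⟨h1, r, h2, h3⟩ := card_cancels_and_card_support g ht hx.symm rfl rfl
  rw [h1, h2, h3]
  have hy : t x ≠ t (t x) := fun h => hx (t.injective h).symm
  have hz : t (t x) ≠ x := fun h => by
    have := ht.cube_apply x
    rw [h] at this
    exact hx this
  have hA : g (t x) = x → g x ≠ x ∧ g (t x) ≠ t x := fun h =>
    ⟨fun h' => hx (g.injective (h.trans h'.symm)), h.trans_ne hx.symm⟩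
  have hB : g (t (t x)) = t x → g (t x) ≠ t x ∧ g (t (t x)) ≠ t (t x) := fun h =>
    ⟨fun h' => hy.symm (g.injective (h.trans h'.symm)), h.trans_ne hy⟩
  have hC : g x = t (t x) → g (t (t x)) ≠ t (t x) ∧ g x ≠ x := fun h =>
    ⟨fun h' => hz.symm (g.injective (h.trans h'.symm)), h.trans_ne hz⟩
  clear h1 h2 h3
  by_cases A : g (t x) = x <;> by_cases B : g (t (t x)) = t x <;> by_cases C : g x = t (t x) <;>
    simp only [A, B, C, true_imp_iff, ne_eq, false_imp_iff] at hA hB hC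
  all_goals simp [A, B, C, hA, hB, hC]
  all_goals try split_ifs
  all_goals try omega

lemma Cancels.card_support_iff {g t : Perm α} {c : α} (hc : Cancels g c t)
    (ht : t.IsThreeCycle) : #(g * t).support + 3 = #g.support ↔ g (g (g c)) = c := by
  obtain ⟨h0, h1, h2⟩ := hc
  have hx : g c ≠ g (g c) := fun h => h0 (g.injective h).symm
  obtain ⟨-, r, h3, h4⟩ := card_cancels_and_card_support g ht hx.symm h1 h2
  rw [h3, h4]
  have n1 : g (g (g c)) ≠ g (g c) := fun h => h0 (g.injective (g.injective h))
  have n2 : g (g c) ≠ g c := fun h => h0 (g.injective h)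
  by_cases C : g (g (g c)) = c
  · rw [C] at n1
    simp [C, h0, n1, n2]
  · simp [C, h0, n1, n2]

lemma exists_cancels {g : Perm α} {c : α} (h1 : g c ≠ c) (h2 : g (g c) ≠ c) :
    ∃ t : Perm α, t.IsThreeCycle ∧ Cancels g c t := by
  have h3 : g (g c) ≠ g c := fun h => h1 (g.injective h)
  refine ⟨swap (g (g c)) c * swap (g (g c)) (g c), isThreeCycle_swap_mul_swap_same h2 h3 h1.symm,
    h1, ?_, ?_⟩
  · rw [Perm.mul_apply, swap_apply_left, swap_apply_of_ne_of_ne h3.symm h1]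
  · rw [Perm.mul_apply, swap_apply_right, swap_apply_left]

lemma Cancels.apply_self {g t : Perm α} {c : α} (hc : Cancels g c t) (ht : t.IsThreeCycle) :
    t c = g (g c) := by
  have := ht.cube_apply (g (g c))
  rwa [hc.2.1, hc.2.2] at this

lemma Cancels.ne {g t : Perm α} {c : α} (hc : Cancels g c t) (ht : t.IsThreeCycle) :
    g (g c) ≠ c := by
  intro h
  have h1 := hc.apply_self ht
  have h2 := hc.2.1
  rw [h, h1, h] at h2
  exact hc.1 h2.symm

lemma Cancels.apply_eq {g t : Perm α} {c : α} (hc : Cancels g c t) (ht : t.IsThreeCycle) {y : α}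
    (h0 : y ≠ c) (h1 : y ≠ g c) (h2 : y ≠ g (g c)) : t y = y := by
  by_contra hy
  have hx : t c ≠ c := by rw [hc.apply_self ht]; exact hc.ne ht
  rcases ht.eq_of_apply_ne hx hy with h | h | h
  · exact h0 h
  · exact h2 (h.trans (hc.apply_self ht))
  · exact h1 (h.trans (by rw [hc.apply_self ht, hc.2.1]))

lemma Cancels.unique {g t t' : Perm α} {c : α} (hc : Cancels g c t) (ht : t.IsThreeCycle)
    (hc' : Cancels g c t') (ht' : t'.IsThreeCycle) : t = t' := by
  ext y
  by_cases h0 : y = c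
  · rw [h0, hc.apply_self ht, hc'.apply_self ht']
  by_cases h1 : y = g c
  · rw [h1, hc.2.2, hc'.2.2]
  by_cases h2 : y = g (g c)
  · rw [h2, hc.2.1, hc'.2.1]
  rw [hc.apply_eq ht h0 h1 h2, hc'.apply_eq ht' h0 h1 h2]

open Classical in
lemma sum_card_cancels (g : Perm α) (Q : Perm α → Prop) :
    ∑ t : {t : Perm α // t.IsThreeCycle}, (if Q t then #{c | Cancels g c t} else 0) =
      #{c | ∃ t : Perm α, t.IsThreeCycle ∧ Cancels g c t ∧ Q t} := by
  have h1 : ∀ t : {t : Perm α // t.IsThreeCycle}, (if Q t then #{c | Cancels g c t} else 0) =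
      ∑ c, if Cancels g c t ∧ Q t then 1 else 0 := by
    intro t
    by_cases hQ : Q t <;> simp [hQ]
  simp only [h1]
  rw [sum_comm, card_filter]
  refine sum_congr rfl fun c _ => ?_
  by_cases h : ∃ t : Perm α, t.IsThreeCycle ∧ Cancels g c t ∧ Q t
  · rw [if_pos h]
    obtain ⟨t, ht, hc, hQ⟩ := h
    rw [sum_eq_single ⟨t, ht⟩, if_pos ⟨hc, hQ⟩]
    · intro t' _ hne
      rw [if_neg]
      rintro ⟨hc', -⟩
      exact hne (Subtype.ext (hc'.unique t'.2 hc ht))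
    · simp
  · rw [if_neg h]
    refine sum_eq_zero fun t _ => if_neg fun ⟨hc, hQ⟩ => h ⟨t, t.2, hc, hQ⟩

lemma Equiv.Perm.minimalPeriod_pos {β : Type} [Finite β] (g : Perm β) (c : β) :
    0 < minimalPeriod g c :=
  minimalPeriod_pos_of_mem_periodicPts (g.injective.mem_periodicPts c)

namespace Cancels

variable {g t : Perm α} {c : α}

lemma three_le (hc : Cancels g c t) (ht : t.IsThreeCycle) : 3 ≤ minimalPeriod g c := by
  have h0 := minimalPeriod_pos g c
  have h := isPeriodicPt_minimalPeriod g c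
  by_contra hlt
  have : minimalPeriod g c = 1 ∨ minimalPeriod g c = 2 := by omega
  rcases this with h1 | h1 <;> rw [h1] at h
  exacts [hc.1 h, hc.ne ht h]

lemma iterate_mul_apply (hc : Cancels g c t) (ht : t.IsThreeCycle) {i : ℕ}
    (hi : i + 3 ≤ minimalPeriod g c) : (⇑(g * t))^[i + 1] c = g^[i + 3] c := by
  induction i with
  | zero =>
    change g (t c) = _
    rw [hc.apply_self ht]; rfl
  | succ i ih =>
    have hne : ∀ j < 3, g^[i + 3] c ≠ g^[j] c := fun j hj h => by
      have := (iterate_eq_iterate_iff_of_lt_minimalPeriod (by omega) (by omega)).mp h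
      omega
    rw [iterate_succ_apply', ih (by omega), Perm.mul_apply,
      hc.apply_eq ht (hne 0 (by omega)) (hne 1 (by omega)) (hne 2 (by omega)),
      ← iterate_succ_apply' g]

lemma minimalPeriod_mul_self (hc : Cancels g c t) (ht : t.IsThreeCycle) :
    minimalPeriod (g * t) c = minimalPeriod g c - 2 := by
  have h3 := hc.three_le ht
  have hper : IsPeriodicPt (g * t) (minimalPeriod g c - 2) c := by
    have := hc.iterate_mul_apply ht (i := minimalPeriod g c - 3) (by omega)
    rw [show minimalPeriod g c - 3 + 1 = minimalPeriod g c - 2 by omega,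
      Nat.sub_add_cancel h3, iterate_minimalPeriod] at this
    exact this
  refine le_antisymm (hper.minimalPeriod_le (by omega)) ?_
  by_contra! hlt
  have h0 := minimalPeriod_pos (g * t) c
  have h := isPeriodicPt_minimalPeriod (g * t) c
  have := hc.iterate_mul_apply ht (i := minimalPeriod (g * t) c - 1) (by omega)
  rw [Nat.sub_add_cancel h0, h] at this
  have h4 := (IsPeriodicPt.minimalPeriod_le (f := g) (x := c) (by omega) this.symm)
  omega

lemma minimalPeriod_mul_of_mem (hc : Cancels g c t) (ht : t.IsThreeCycle) (i : ℕ) :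
    minimalPeriod (g * t) (g^[i] c) = 1 ∨
      minimalPeriod (g * t) (g^[i] c) = minimalPeriod g c - 2 := by
  rw [← iterate_mod_minimalPeriod_eq]
  have hlt := Nat.mod_lt i (minimalPeriod_pos g c)
  generalize i % minimalPeriod g c = i at hlt
  match i with
  | 0 => exact Or.inr (hc.minimalPeriod_mul_self ht)
  | 1 =>
    refine Or.inl (minimalPeriod_eq_one_iff_isFixedPt.mpr ?_)
    change g (t (g c)) = g c
    rw [hc.2.2]
  | 2 =>
    refine Or.inl (minimalPeriod_eq_one_iff_isFixedPt.mpr ?_)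
    change g (t (g (g c))) = g (g c)
    rw [hc.2.1]
  | i + 3 =>
    right
    rw [← hc.iterate_mul_apply ht hlt.le,
      minimalPeriod_apply_iterate ((g * t).injective.mem_periodicPts c),
      hc.minimalPeriod_mul_self ht]

lemma minimalPeriod_mul_of_notMem (hc : Cancels g c t) (ht : t.IsThreeCycle) {y : α}
    (hy : ∀ i, y ≠ g^[i] c) : minimalPeriod (g * t) y = minimalPeriod g y := by
  have hstep : ∀ y, (∀ i, y ≠ g^[i] c) → ∀ i, g y ≠ g^[i] c := by
    intro y hy i h
    rw [← iterate_add_minimalPeriod_eq] at h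
    have := minimalPeriod_pos g c
    rw [show i + minimalPeriod g c = (i + minimalPeriod g c - 1) + 1 by omega,
      iterate_succ_apply'] at h
    exact hy _ (g.injective h)
  have hit : ∀ n, (⇑(g * t))^[n] y = g^[n] y ∧ ∀ i, g^[n] y ≠ g^[i] c := by
    intro n
    induction n with
    | zero => exact ⟨rfl, hy⟩
    | succ n ih =>
      obtain ⟨h1, h2⟩ := ih
      rw [iterate_succ_apply', iterate_succ_apply', h1, Perm.mul_apply,
        hc.apply_eq ht (h2 0) (h2 1) (h2 2)]
      exact ⟨rfl, hstep _ h2⟩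
  rw [minimalPeriod_eq_minimalPeriod_iff]
  intro n
  rw [IsPeriodicPt, IsPeriodicPt, IsFixedPt, IsFixedPt, (hit n).1]

lemma periodCount_lt_iff (hc : Cancels g c t) (ht : t.IsThreeCycle) {j : ℕ} (hj : 2 ≤ j) :
    periodCount g j < periodCount (g * t) j ↔ minimalPeriod g c = j + 2 := by
  have h3 := hc.three_le ht
  constructor
  · intro hlt
    by_contra hne
    refine hlt.not_ge (card_le_card fun y hy => ?_)
    simp only [mem_filter, mem_univ, true_and] at hy ⊢
    by_cases h : ∃ i, y = g^[i] c
    · obtain ⟨i, rfl⟩ := h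
      rcases hc.minimalPeriod_mul_of_mem ht i with h | h <;> omega
    · push Not at h
      rw [← hy, hc.minimalPeriod_mul_of_notMem ht h]
  · intro heq
    refine card_lt_card (Finset.ssubset_iff_subset_ne.mpr ⟨fun y hy => ?_, fun h => ?_⟩)
    · simp only [mem_filter, mem_univ, true_and] at hy ⊢
      by_cases h : ∃ i, y = g^[i] c
      · obtain ⟨i, rfl⟩ := h
        rw [minimalPeriod_apply_iterate (g.injective.mem_periodicPts c)] at hy
        omega
      · push Not at h
        rw [← hy, hc.minimalPeriod_mul_of_notMem ht h]
    · have hcm : c ∈ ({a | minimalPeriod (g * t) a = j} : Finset α) := by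
        simp only [mem_filter, mem_univ, true_and]
        rw [hc.minimalPeriod_mul_self ht]; omega
      rw [← h] at hcm
      simp only [mem_filter, mem_univ, true_and] at hcm
      omega

end Cancels

lemma isThreeCycle_of_ne {a b c : α} (hab : a ≠ b) (hac : a ≠ c) (hbc : b ≠ c) :
    ∃ t : Perm α, t.IsThreeCycle ∧ t a = b ∧ t b = c ∧ t c = a := by
  refine ⟨swap a c * swap a b, isThreeCycle_swap_mul_swap_same hac hab hbc.symm, ?_, ?_, ?_⟩
  · rw [Perm.mul_apply, swap_apply_left, swap_apply_of_ne_of_ne hab.symm hbc]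
  · rw [Perm.mul_apply, swap_apply_right, swap_apply_left]
  · rw [Perm.mul_apply, swap_apply_of_ne_of_ne hac.symm hbc.symm, swap_apply_right]

open Classical in
/-- Many `3`-cycles shrink the support of `g`. -/
lemma sum_le_card_support_mul_lt (g : Perm α) :
    ∑ u ∈ g.support, (#g.support - #{u, g u, g⁻¹ u}) ≤
      #{t : {t : Perm α // t.IsThreeCycle} | #(g * t.1).support < #g.support} := by
  set P : Finset (Σ _ : α, α) := g.support.sigma fun u => g.support \ {u, g u, g⁻¹ u} with hP
  have hmem : ∀ p ∈ P, g p.1 ≠ p.1 ∧ g p.2 ≠ p.2 ∧ p.2 ≠ p.1 ∧ p.2 ≠ g p.1 ∧ g p.2 ≠ p.1 := by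
    rintro ⟨u, b⟩ h
    simp only [hP, mem_sigma, Perm.mem_support, mem_sdiff, mem_insert, Finset.mem_singleton,
      not_or] at h
    exact ⟨h.1, h.2.1, h.2.2.1, h.2.2.2.1, fun h' => h.2.2.2.2 (Perm.eq_inv_iff_eq.mpr h')⟩
  have hex : ∀ p ∈ P, ∃ t : {t : Perm α // t.IsThreeCycle},
      t.1 (g p.1) = p.1 ∧ t.1 p.1 = p.2 ∧ t.1 p.2 = g p.1 := by
    intro p hp
    obtain ⟨h1, h2, h3, h4, h5⟩ := hmem p hp
    obtain ⟨t, ht, h⟩ := isThreeCycle_of_ne h1 h4.symm h3.symm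
    exact ⟨⟨t, ht⟩, h⟩
  calc _ ≤ ∑ u ∈ g.support, #(g.support \ {u, g u, g⁻¹ u}) :=
        sum_le_sum fun u _ => le_card_sdiff _ _
    _ = #P := (card_sigma _ _).symm
    _ ≤ _ := by
      rcases P.eq_empty_or_nonempty with h0 | ⟨p₀, hp₀⟩
      · simp [h0]
      have : Nonempty {t : Perm α // t.IsThreeCycle} := ⟨(hex p₀ hp₀).choose⟩
      choose! t ht using hex
      refine card_le_card_of_injOn t (fun p hp => ?_) fun p hp p' hp' heq => ?_
      · obtain ⟨h1, h2, h3, h4, h5⟩ := hmem p hp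
        obtain ⟨e1, e2, e3⟩ := ht p hp
        simp only [coe_filter, mem_univ, true_and, Set.mem_ofPred_eq]
        refine card_lt_card (Finset.ssubset_iff_of_subset (fun y hy => ?_) |>.mpr
          ⟨g p.1, ?_, ?_⟩)
        · rw [Perm.mem_support] at hy ⊢
          by_cases hty : (t p).1 y = y
          · rwa [Perm.mul_apply, hty] at hy
          · rcases (t p).2.eq_of_apply_ne (x := p.1) (by rwa [e2]) hty with h | h | h
            · rwa [h]
            · rwa [h, e2]
            · rw [h, e2, e3]; exact fun h => h1 (g.injective h)
        · rw [Perm.mem_support]; exact fun h => h1 (g.injective h)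
        · rw [Perm.mem_support, Perm.mul_apply, e1, not_not]
      · obtain ⟨h1, h2, h3, h4, h5⟩ := hmem p hp
        obtain ⟨e1, e2, e3⟩ := ht p hp
        obtain ⟨h1', h2', h3', h4', h5'⟩ := hmem p' hp'
        obtain ⟨e1', e2', e3'⟩ := ht p' hp'
        rw [← heq] at e1' e2' e3'
        have hp1 : p'.1 = p.1 := by
          rcases (t p).2.eq_of_apply_ne (x := p.1) (y := p'.1) (by rwa [e2]) (by rwa [e2'])
            with h | h | h
          · exact h
          · rw [e2] at h
            have := (t p).1.injective (e1'.trans (h.trans e2.symm))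
            rw [h] at this
            exact absurd this h5
          · rw [e2, e3] at h
            rw [h, e1] at e2'
            rw [h] at h5'
            exact absurd (by rw [← e2']) h5'
        have hp2 : p'.2 = p.2 := by rw [← e2', hp1, e2]
        exact Sigma.ext hp1.symm (heq_of_eq hp2.symm)

lemma apply_apply_of_card_support_eq_four {g : Perm α} (h4 : #g.support = 4) (hs : sign g = 1)
    (x : α) : g (g x) = x := by
  have hsum := g.sum_cycleType
  rw [h4] at hsum
  have h2 : ∀ a ∈ g.cycleType, a = 2 := by
    intro a ha
    obtain ⟨m, hm⟩ := Multiset.exists_cons_of_mem ha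
    have ha2 := two_le_of_mem_cycleType ha
    rw [hm, Multiset.sum_cons] at hsum
    have hm0 : m ≠ 0 := by
      rintro rfl
      have ha4 : a = 4 := by simpa using hsum
      rw [sign_of_cycleType, hm, ha4] at hs
      exact absurd hs (by decide)
    obtain ⟨b, hb⟩ := Multiset.exists_mem_of_ne_zero hm0
    have hb2 := two_le_of_mem_cycleType (σ := g) (n := b) (by rw [hm]; simp [hb])
    have := Multiset.le_sum_of_mem hb
    omega
  have : g ^ 2 = 1 := by
    rw [← orderOf_dvd_iff_pow_eq_one, ← lcm_cycleType, Multiset.lcm_dvd]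
    exact fun b hb => (h2 b hb).dvd
  exact congrArg (· x) this

lemma card_support_add_periodCount (g : Perm α) :
    #g.support + periodCount g 1 = Fintype.card α := by
  rw [← card_univ, ← card_filter_add_card_filter_not (s := univ) fun x => g x ≠ x, periodCount]
  congr 2
  · ext; simp [minimalPeriod_eq_one_iff_isFixedPt, IsFixedPt]

open Classical in
lemma card_support_mul_add_two_le (g : Perm α) :
    #{t : {t : Perm α // t.IsThreeCycle} | #(g * t.1).support + 2 ≤ #g.support} ≤
      #g.support := by
  have h := sum_card_cancels g fun _ => True
  simp only [if_true, and_true] at h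
  calc _ = ∑ t : {t : Perm α // t.IsThreeCycle},
        if #(g * t.1).support + 2 ≤ #g.support then 1 else 0 := card_filter _ _
    _ ≤ ∑ t : {t : Perm α // t.IsThreeCycle}, #{c | Cancels g c t} := by
      refine sum_le_sum fun t _ => ?_
      split_ifs with h
      · rcases card_cancels_cases g t.2 with h | h | h <;> omega
      · omega
    _ = _ := h
    _ ≤ _ := card_le_card fun c hc => by
      obtain ⟨t, -, hc⟩ := (mem_filter.mp hc).2
      exact Perm.mem_support.mpr hc.1

/-- A relation on permutations compatible with multiplication by `3`-cycles. -/
structure RespectsThreeCycles (R : Perm α → Perm α → Prop) : Prop where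
  exists_equiv : ∀ {g h}, R g h → ∃ e : {t : Perm α // t.IsThreeCycle} ≃
    {t : Perm α // t.IsThreeCycle}, ∀ t : {t : Perm α // t.IsThreeCycle}, R (g * t) (h * e t)
  eq_one_iff : ∀ {g h}, R g h → (g = 1 ↔ h = 1)
  isThreeCycle_iff : ∀ {g h}, R g h → (g.IsThreeCycle ↔ h.IsThreeCycle)
  sign_left : ∀ {g h}, R g h → sign g = 1
  sign_right : ∀ {g h}, R g h → sign h = 1

namespace RespectsThreeCycles

variable {R : Perm α → Perm α → Prop}

lemma flip (hR : RespectsThreeCycles R) : RespectsThreeCycles fun g h => R h g where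
  exists_equiv h := by
    obtain ⟨e, he⟩ := hR.exists_equiv h
    exact ⟨e.symm, fun t => by simpa using he (e.symm t)⟩
  eq_one_iff h := (hR.eq_one_iff h).symm
  isThreeCycle_iff h := (hR.isThreeCycle_iff h).symm
  sign_left h := hR.sign_right h
  sign_right h := hR.sign_left h

lemma card_support_eq (hR : RespectsThreeCycles R) {g h : Perm α} (hgh : R g h)
    (hk : #g.support ≤ #h.support)
    (IH : ∀ g' h', R g' h' → (#g'.support < #g.support ∨ #h'.support < #g.support) →
      #g'.support = #h'.support) : #g.support = #h.support := by
  classical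
  by_contra hne
  have hlt := lt_of_le_of_ne hk hne
  obtain ⟨e, he⟩ := hR.exists_equiv hgh
  have hNe : #{t : {t : Perm α // t.IsThreeCycle} | #(g * t.1).support < #g.support} =
      #{t : {t : Perm α // t.IsThreeCycle} | #(h * t.1).support < #g.support} := by
    refine card_equiv e fun t => ?_
    simp only [mem_filter, mem_univ, true_and]
    constructor
    · intro h'
      rwa [← IH _ _ (he t) (Or.inl h')]
    · intro h'
      rwa [IH _ _ (he t) (Or.inr h')]
  have hup : #{t : {t : Perm α // t.IsThreeCycle} | #(h * t.1).support < #g.support} ≤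
      #h.support := by
    refine le_trans (card_le_card fun t ht => ?_) (card_support_mul_add_two_le h)
    simp only [mem_filter, mem_univ, true_and] at ht ⊢
    omega
  have hlow := sum_le_card_support_mul_lt g
  rw [hNe] at hlow
  have hle : 0 < #{t : {t : Perm α // t.IsThreeCycle} | #(h * t.1).support < #g.support} →
      #h.support ≤ #g.support + 2 := by
    intro hpos
    obtain ⟨t, ht⟩ := card_pos.mp hpos
    have := (mem_filter.mp ht).2
    rcases card_cancels_cases h t.2 with h | h | h <;> omega
  rcases Nat.lt_or_ge 4 #g.support with h5 | h5
  · have : #g.support * (#g.support - 3) ≤ ∑ u ∈ g.support, (#g.support - #{u, g u, g⁻¹ u}) := by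
      rw [← smul_eq_mul]
      exact card_nsmul_le_sum _ _ _ fun u _ => Nat.sub_le_sub_left card_le_three _
    replace this := this.trans hlow
    obtain ⟨m, hm⟩ := Nat.exists_eq_add_of_le h5
    rw [hm, show 4 + 1 + m - 3 = m + 2 by omega] at this
    rw [hm] at hle hup
    have h1 := hle (by nlinarith)
    rw [hm] at hlt
    nlinarith
  rcases Nat.lt_or_ge 3 #g.support with h4 | h4
  · have h4 : #g.support = 4 := by omega
    have h2 := apply_apply_of_card_support_eq_four h4 (hR.sign_left hgh)
    have : #g.support * (#g.support - 2) ≤ ∑ u ∈ g.support, (#g.support - #{u, g u, g⁻¹ u}) := by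
      rw [← smul_eq_mul]
      refine card_nsmul_le_sum _ _ _ fun u _ => Nat.sub_le_sub_left ?_ _
      have : g⁻¹ u = g u := Perm.inv_eq_iff_eq.mpr (h2 u).symm
      rw [this]
      simpa using card_le_two (a := u) (b := g u)
    replace this := this.trans hlow
    rw [h4] at this hle hup
    have h1 := hle (by omega)
    omega
  have h012 : #g.support = 0 ∨ #g.support = 1 ∨ #g.support = 2 ∨ #g.support = 3 := by omega
  rcases h012 with h0 | h0 | h0 | h0
  · have := (hR.eq_one_iff hgh).mp (by simpa using h0)
    rw [this] at hlt
    simp at hlt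
  · exact card_support_ne_one g h0
  · have := (card_support_eq_two.mp h0).sign_eq
    rw [hR.sign_left hgh] at this
    exact absurd this (by decide)
  · have := (hR.isThreeCycle_iff hgh).mp (card_support_eq_three_iff.mp h0)
    rw [h0, this.card_support] at hlt
    omega

/-- The counting argument when both supports have the same size. -/
lemma card_exists_cancels_eq (hR : RespectsThreeCycles R) {g h : Perm α} (hgh : R g h)
    (hk : #g.support = #h.support)
    (IH : ∀ g' h', R g' h' → (#g'.support < #g.support ∨ #h'.support < #g.support) →
      periodCount g' = periodCount h') (Q : (ℕ → ℕ) → Prop) :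
    Nat.card {c // ∃ t : Perm α, t.IsThreeCycle ∧ Cancels g c t ∧ Q (periodCount (g * t))} =
    Nat.card {c // ∃ t : Perm α, t.IsThreeCycle ∧ Cancels h c t ∧ Q (periodCount (h * t))} := by
  classical
  obtain ⟨e, he⟩ := hR.exists_equiv hgh
  have h1 := sum_card_cancels g fun q => Q (periodCount (g * q))
  have h2 := sum_card_cancels h fun q => Q (periodCount (h * q))
  rw [Nat.card_eq_fintype_card, Nat.card_eq_fintype_card, Fintype.card_subtype,
    Fintype.card_subtype]
  refine h1.symm.trans (Eq.trans ?_ h2)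
  refine Fintype.sum_equiv e _ _ fun t => ?_
  have c1 := card_cancels_cases g t.2
  have c2 := card_cancels_cases h (e t).2
  by_cases hlt : #(g * t.1).support < #g.support ∨ #(h * (e t).1).support < #g.support
  · have hP := IH _ _ (he t) hlt
    have hs1 := card_support_add_periodCount (g * t.1)
    have hs2 := card_support_add_periodCount (h * (e t).1)
    rw [hP]
    rw [hP] at hs1
    congr 1
    omega
  · have e1 : #{c | Cancels g c t} = 0 := by omega
    have e2 : #{c | Cancels h c (e t)} = 0 := by omega
    rw [e1, e2]
    simp

lemma periodCount_eq_of_le (hR : RespectsThreeCycles R) {g h : Perm α} (hgh : R g h)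
    (hk : #g.support ≤ #h.support)
    (IH : ∀ g' h', R g' h' → (#g'.support < #g.support ∨ #h'.support < #g.support) →
      periodCount g' = periodCount h') : periodCount g = periodCount h := by
  classical
  have hs : #g.support = #h.support := by
    refine hR.card_support_eq hgh hk fun g' h' h1 h2 => ?_
    have h3 := card_support_add_periodCount g'
    have h4 := card_support_add_periodCount h'
    rw [IH g' h' h1 h2] at h3
    omega
  have key := hR.card_exists_cancels_eq hgh hs IH
  have h1 : periodCount g 1 = periodCount h 1 := by
    have h3 := card_support_add_periodCount g
    have h4 := card_support_add_periodCount h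
    omega
  have count : ∀ (g : Perm α) (Q : Perm α → Prop) (l : ℕ), 3 ≤ l →
      (∀ c t, t.IsThreeCycle → Cancels g c t → (Q t ↔ minimalPeriod g c = l)) →
      Nat.card {c // ∃ t : Perm α, t.IsThreeCycle ∧ Cancels g c t ∧ Q t} = periodCount g l := by
    intro g Q l hl hQ
    rw [Nat.card_eq_fintype_card, Fintype.card_subtype]
    refine congrArg card (filter_congr fun c _ => ⟨?_, fun hc => ?_⟩)
    · rintro ⟨t, ht, hct, hq⟩
      exact (hQ c t ht hct).mp hq
    · have hne : ∀ j, 0 < j → j < 3 → ¬ IsPeriodicPt g j c := fun j h0 hj =>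
        not_isPeriodicPt_of_pos_of_lt_minimalPeriod h0.ne' (by omega)
      obtain ⟨t, ht, hct⟩ := exists_cancels (hne 1 (by omega) (by omega))
        (hne 2 (by omega) (by omega))
      exact ⟨t, ht, hct, (hQ c t ht hct).mpr hc⟩
  have h3 : periodCount g 3 = periodCount h 3 := by
    have hQ : ∀ g : Perm α, ∀ c t, t.IsThreeCycle → Cancels g c t →
        (periodCount (g * t) 1 = periodCount g 1 + 3 ↔ minimalPeriod g c = 3) := by
      intro g c t ht hct
      have e1 := card_support_add_periodCount g
      have e2 := card_support_add_periodCount (g * t)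
      have e3 := hct.card_support_iff ht
      have e4 : g (g (g c)) = c ↔ IsPeriodicPt g 3 c := Iff.rfl
      rw [isPeriodicPt_iff_minimalPeriod_dvd] at e4
      have e5 := hct.three_le ht
      have e6 : minimalPeriod g c ∣ 3 ↔ minimalPeriod g c = 3 :=
        ⟨fun h => le_antisymm (Nat.le_of_dvd (by omega) h) e5, fun h => h.dvd⟩
      rw [← e6, ← e4, ← e3]
      omega
    rw [← count g _ 3 le_rfl (hQ g), ← count h _ 3 le_rfl (hQ h), ← h1]
    exact key fun P => P 1 = periodCount g 1 + 3
  have hstep : ∀ j, 2 ≤ j → periodCount g j = periodCount h j →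
      periodCount g (j + 2) = periodCount h (j + 2) := by
    intro j hj heq
    have hQ := fun (g : Perm α) c t (ht : t.IsThreeCycle) (hct : Cancels g c t) =>
      hct.periodCount_lt_iff ht hj
    rw [← count g _ (j + 2) (by omega) (hQ g), ← count h _ (j + 2) (by omega) (hQ h), ← heq]
    exact key fun P => periodCount g j < P j
  have h2 : periodCount g 2 = periodCount h 2 := by
    have aux : ∀ g : Perm α, #g.support = periodCount g 2 +
        Nat.card {c // ∃ t : Perm α, t.IsThreeCycle ∧ Cancels g c t ∧ True} := by
      intro g
      rw [Nat.card_eq_fintype_card, Fintype.card_subtype, periodCount,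
        ← card_union_of_disjoint]
      · congr 1
        ext c
        simp only [Perm.mem_support, mem_union, mem_filter, mem_univ, true_and, and_true]
        constructor
        · intro h1
          by_cases h2 : g (g c) = c
          · left
            have h3 : IsPeriodicPt g 2 c := h2
            have h4 := h3.minimalPeriod_le (by omega)
            have h5 := minimalPeriod_pos g c
            have h6 : minimalPeriod g c ≠ 1 := fun h =>
              h1 (minimalPeriod_eq_one_iff_isFixedPt.mp h)
            omega
          · exact Or.inr (exists_cancels h1 h2)
        · rintro (h | ⟨t, -, h⟩)
          · intro h'
            rw [minimalPeriod_eq_one_iff_isFixedPt.mpr h'] at h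
            omega
          · exact h.1
      · refine disjoint_filter.mpr fun c _ hc ⟨t, ht, hct, _⟩ => ?_
        have := hct.three_le ht
        omega
    have := key fun _ => True
    have e1 := aux g
    have e2 := aux h
    omega
  funext l
  induction l using Nat.strong_induction_on with
  | _ l ih =>
    match l with
    | 0 =>
      have : ∀ g : Perm α, periodCount g 0 = 0 := fun g =>
        card_eq_zero.mpr (filter_eq_empty_iff.mpr fun c _ => (minimalPeriod_pos g c).ne')
      rw [this, this]
    | 1 => exact h1
    | 2 => exact h2
    | 3 => exact h3
    | j + 4 => exact hstep (j + 2) (by omega) (ih (j + 2) (by omega))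

theorem periodCount_eq (hR : RespectsThreeCycles R) {g h : Perm α} (hgh : R g h) :
    periodCount g = periodCount h := by
  suffices H : ∀ k, ∀ R : Perm α → Perm α → Prop, RespectsThreeCycles R → ∀ g h, R g h →
      #g.support = k → #g.support ≤ #h.support → periodCount g = periodCount h by
    rcases le_total #g.support #h.support with hle | hle
    · exact H _ R hR g h hgh rfl hle
    · exact (H _ _ hR.flip h g hgh rfl hle).symm
  intro k
  induction k using Nat.strong_induction_on with
  | _ k ih =>
    rintro R hR g h hgh rfl hle
    refine hR.periodCount_eq_of_le hgh hle fun g' h' h1 h2 => ?_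
    rcases le_total #g'.support #h'.support with hle' | hle'
    · exact ih _ (by omega) R hR g' h' h1 rfl hle'
    · exact (ih _ (by omega) _ hR.flip h' g' h1 rfl hle').symm

theorem orderOf_eq (hR : RespectsThreeCycles R) {g h : Perm α} (hgh : R g h) :
    orderOf g = orderOf h := by
  have hP := hR.periodCount_eq hgh
  have aux : ∀ (g : Perm α) m, g ^ m = 1 ↔ ∀ l, ¬ l ∣ m → periodCount g l = 0 := by
    intro g m
    constructor
    · intro h l hl
      refine card_eq_zero.mpr (filter_eq_empty_iff.mpr fun c _ hc => hl ?_)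
      rw [← hc, ← isPeriodicPt_iff_minimalPeriod_dvd, IsPeriodicPt, iterate_eq_pow, h]
      exact rfl
    · intro h
      ext c
      have : minimalPeriod g c ∣ m := by
        by_contra hl
        exact filter_eq_empty_iff.mp (card_eq_zero.mp (h _ hl)) (mem_univ c) rfl
      rw [← isPeriodicPt_iff_minimalPeriod_dvd, IsPeriodicPt, iterate_eq_pow] at this
      exact this
  refine orderOf_eq_orderOf_iff.mpr fun m => ?_
  rw [aux, aux, hP]

end RespectsThreeCycles

end ThreeCycles

section CentralizerCard

open Equiv Equiv.Perm Finset

/-- The order of the centralizer in the symmetric group on `n` letters of a permutation of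
cycle type `m`. -/
def centralizerCard (n : ℕ) (m : Multiset ℕ) : ℕ :=
  (n - m.sum).factorial * (m.prod * ∏ i ∈ m.toFinset, (m.count i).factorial)

/-- The order of the centralizer in the alternating group on `n` letters of an even permutation
of cycle type `m`. -/
def altCentralizerCard (n : ℕ) (m : Multiset ℕ) : ℕ :=
  if (∀ c ∈ m, Odd c) ∧ n ≤ m.sum + 1 ∧ m.Nodup then centralizerCard n m
  else centralizerCard n m / 2

theorem nat_card_centralizer_singleton_eq {G : Type} [Group G] [Finite G] {g h : G}
    (hc : Nat.card {x // ConjClasses.mk x = ConjClasses.mk g} =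
      Nat.card {x // ConjClasses.mk x = ConjClasses.mk h}) :
    Nat.card (Subgroup.centralizer {g}) = Nat.card (Subgroup.centralizer {h}) := by
  classical
  have := Fintype.ofFinite G
  have key (g : G) : Nat.card {x // ConjClasses.mk x = ConjClasses.mk g} *
      Nat.card (Subgroup.centralizer {g}) = Nat.card G := by
    rw [Subgroup.nat_card_centralizer_nat_card_stabilizer]
    have := MulAction.card_orbit_mul_card_stabilizer_eq_card_group (ConjAct G) g
    rw [← Nat.card_eq_fintype_card, ← Nat.card_eq_fintype_card, ← Nat.card_eq_fintype_card,
      ConjAct.orbit_eq_carrier_conjClasses] at this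
    exact Eq.trans (congrArg (· * _) (Nat.card_congr (Equiv.subtypeEquivRight fun x =>
      ConjClasses.mem_carrier_iff_mk_eq.symm))) this
  have hpos : 0 < Nat.card {x // ConjClasses.mk x = ConjClasses.mk h} :=
    have : Nonempty {x // ConjClasses.mk x = ConjClasses.mk h} := ⟨⟨h, rfl⟩⟩
    Nat.card_pos
  have h1 := key g
  rw [hc, ← key h] at h1
  exact Nat.eq_of_mul_eq_mul_left hpos h1

theorem nat_card_centralizer_alternatingGroup {α : Type} [Fintype α] [DecidableEq α]
    (g : alternatingGroup α) :
    Nat.card (Subgroup.centralizer {g}) =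
      altCentralizerCard (Fintype.card α) (g : Perm α).cycleType := by
  set C := Subgroup.centralizer {(g : Perm α)} with hC
  have hz : Nat.card C = centralizerCard (Fintype.card α) (g : Perm α).cycleType := by
    rw [hC, Equiv.Perm.nat_card_centralizer, centralizerCard, mul_assoc]
  have hA : Nat.card (Subgroup.centralizer {g}) = Nat.card ((alternatingGroup α).subgroupOf C) := by
    refine Nat.card_congr
      { toFun := fun x => ⟨⟨x.1, ?_⟩, ?_⟩
        invFun := fun x => ⟨⟨x.1.1, ?_⟩, ?_⟩
        left_inv := fun x => rfl
        right_inv := fun x => rfl }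
    · have := Subgroup.mem_centralizer_singleton_iff.1 x.2
      rw [hC, Subgroup.mem_centralizer_singleton_iff]
      exact congrArg Subtype.val this
    · exact x.1.2
    · exact x.2
    · have := Subgroup.mem_centralizer_singleton_iff.1 x.1.2
      exact Subgroup.mem_centralizer_singleton_iff.2 (Subtype.ext this)
  have hmul := ((alternatingGroup α).subgroupOf C).card_mul_index
  change _ * (alternatingGroup α).relIndex C = _ at hmul
  have hiff := Equiv.Perm.centralizer_le_alternating_iff (g := (g : Perm α))
  rw [← hC, ← Subgroup.relIndex_eq_one, ← Multiset.nodup_iff_count_le_one] at hiff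
  rw [altCentralizerCard, hA, ← hz]
  split_ifs with hD
  · rw [hiff.2 hD, mul_one] at hmul
    exact hmul
  · have hne : (alternatingGroup α).relIndex C ≠ 1 := fun h => hD (hiff.1 h)
    have hdvd : (alternatingGroup α).relIndex C ∣ 2 := by
      refine (Subgroup.relIndex_dvd_index_of_normal _ _).trans ?_
      rcases subsingleton_or_nontrivial α with hα | hα
      · rw [Subgroup.index_eq_one.2 (Subsingleton.elim _ _)]
        exact one_dvd _
      · rw [alternatingGroup.index_eq_two]
    have h2 := ((Nat.dvd_prime Nat.prime_two).1 hdvd).resolve_left hne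
    rw [h2] at hmul
    omega

end CentralizerCard

section SmallDegree

/-- The cycle types of the even permutations of at most eight letters. -/
def evenCycleTypesUpToEight : List (Multiset ℕ) :=
  [0, {3}, {5}, {7}, {2, 2}, {4, 2}, {6, 2}, {3, 3}, {5, 3}, {4, 4}, {3, 2, 2}, {2, 2, 2, 2}]

theorem mem_evenCycleTypesUpToEight (m : Multiset ℕ) (h2 : ∀ a ∈ m, 2 ≤ a) (hs : m.sum ≤ 8)
    (he : Even (m.sum + m.card)) : m ∈ evenCycleTypesUpToEight := by
  obtain ⟨l, rfl⟩ : ∃ l : List ℕ, (l : Multiset ℕ) = m := Quot.exists_rep m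
  rcases l with _ | ⟨a, _ | ⟨b, _ | ⟨c, _ | ⟨d, _ | ⟨e, l⟩⟩⟩⟩⟩
  · decide
  · simp at h2 hs
    interval_cases a <;> revert he <;> decide +kernel
  · simp at h2 hs
    have : a ≤ 6 := by omega
    have : b ≤ 6 := by omega
    obtain ⟨ha, hb⟩ := h2
    interval_cases a <;> interval_cases b <;> first | omega | (revert he; decide +kernel)
  · simp at h2 hs
    have : a ≤ 4 := by omega
    have : b ≤ 4 := by omega
    have : c ≤ 4 := by omega
    obtain ⟨ha, hb, hc⟩ := h2
    interval_cases a <;> interval_cases b <;> interval_cases c <;>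
      first | omega | (revert he; decide +kernel)
  · simp at h2 hs
    obtain ⟨ha, hb, hc, hd⟩ := h2
    obtain rfl : a = 2 := by omega
    obtain rfl : b = 2 := by omega
    obtain rfl : c = 2 := by omega
    obtain rfl : d = 2 := by omega
    revert he; decide
  · simp at h2 hs
    omega

theorem lcm_eq_of_altCentralizerCard_eq : ∀ n < 7, ∀ m ∈ evenCycleTypesUpToEight,
    ∀ m' ∈ evenCycleTypesUpToEight, m.sum ≤ n → m'.sum ≤ n → (m = 0 ↔ m' = 0) →
    altCentralizerCard n m = altCentralizerCard n m' → m.lcm = m'.lcm := by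
  decide +kernel

theorem eq_singleton_three_of_altCentralizerCard_eq_of_lt : ∀ n < 9, 7 ≤ n →
    ∀ m ∈ evenCycleTypesUpToEight, m.sum ≤ n →
    altCentralizerCard n m = altCentralizerCard n {3} → m = {3} := by
  decide +kernel

end SmallDegree

section LargeDegree

open Nat

theorem mul_doubleFactorial_sub_le {a s : ℕ} (ha : 2 ≤ a) (has : a ≤ s) :
    s * (s - a)‼ ≤ s‼ := by
  obtain ⟨t, rfl⟩ : ∃ t, s = t + 2 := ⟨s - 2, by omega⟩
  have hm : Monotone (fun n : ℕ => n‼) := by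
    refine monotone_nat_of_le_succ fun n => ?_
    induction n using Nat.twoStepInduction with
    | zero => decide
    | one => decide
    | more n h1 h2 =>
      simp only [Nat.doubleFactorial_add_two] at *
      exact Nat.mul_le_mul (by omega) h1
  rw [Nat.doubleFactorial_add_two]
  exact Nat.mul_le_mul_left _ (hm (by omega))

theorem prod_mul_prod_count_factorial_le (m : Multiset ℕ) (h2 : ∀ a ∈ m, 2 ≤ a) :
    m.prod * ∏ i ∈ m.toFinset, (m.count i)! ≤ (m.sum)‼ := by
  induction m using Multiset.induction_on with
  | empty => simp
  | cons a m ih =>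
    have ha : 2 ≤ a := h2 a (Multiset.mem_cons_self a m)
    have hm : ∀ b ∈ m, 2 ≤ b := fun b hb => h2 b (Multiset.mem_cons_of_mem hb)
    have hprod : ∏ i ∈ (a ::ₘ m).toFinset, ((a ::ₘ m).count i)! =
        (m.count a + 1) * ∏ i ∈ m.toFinset, (m.count i)! := by
      have h1 : ∏ i ∈ m.toFinset, (m.count i)! = ∏ i ∈ (a ::ₘ m).toFinset, (m.count i)! := by
        refine Finset.prod_subset (fun i hi => ?_) fun i _ hi => ?_
        · simp at hi ⊢; exact Or.inr hi
        · simp at hi; simp [hi]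
      have hmem : a ∈ (a ::ₘ m).toFinset := by simp
      rw [h1, ← Finset.mul_prod_erase _ _ hmem, ← Finset.mul_prod_erase _ _ hmem,
        Multiset.count_cons_self, Nat.factorial_succ, mul_assoc]
      congr 2
      refine Finset.prod_congr rfl fun i hi => ?_
      rw [Multiset.count_cons_of_ne (Finset.ne_of_mem_erase hi)]
    have hcount : a * m.count a ≤ m.sum := by
      obtain ⟨u, hu⟩ := Multiset.le_iff_exists_add.1
        (Multiset.le_count_iff_replicate_le.1 (le_refl (m.count a)))
      have := congrArg Multiset.sum hu
      rw [Multiset.sum_add, Multiset.sum_replicate, smul_eq_mul] at this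
      rw [this, mul_comm]
      exact Nat.le_add_right _ _
    rw [hprod, Multiset.prod_cons, Multiset.sum_cons]
    have := mul_doubleFactorial_sub_le ha (Nat.le_add_right a m.sum)
    rw [Nat.add_sub_cancel_left] at this
    calc a * m.prod * ((m.count a + 1) * ∏ i ∈ m.toFinset, (m.count i)!)
        = (a * (m.count a + 1)) * (m.prod * ∏ i ∈ m.toFinset, (m.count i)!) := by ring
      _ ≤ (a + m.sum) * (m.sum)‼ := Nat.mul_le_mul (by linarith) (ih hm)
      _ ≤ _ := this

theorem doubleFactorial_lt_three_mul_factorial {n : ℕ} (hn : 9 ≤ n) :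
    n‼ < 3 * (n - 3)! := by
  induction n using Nat.strong_induction_on with
  | _ n ih =>
    rcases Nat.lt_or_ge n 11 with h | h
    · interval_cases n <;> decide
    · obtain ⟨k, rfl⟩ : ∃ k, n = k + 2 := ⟨n - 2, by omega⟩
      have := ih k (by omega) (by omega)
      obtain ⟨j, rfl⟩ : ∃ j, k = j + 3 := ⟨k - 3, by omega⟩
      have e : j + 3 + 2 - 3 = j + 1 + 1 := by omega
      rw [Nat.doubleFactorial_add_two, e, Nat.factorial_succ, Nat.factorial_succ]
      rw [Nat.add_sub_cancel] at this
      have hj : 6 ≤ j := by omega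
      have : j + 3 + 2 ≤ (j + 1 + 1) * (j + 1) := by nlinarith
      calc _ < (j + 3 + 2) * (3 * j !) := by
            apply Nat.mul_lt_mul_of_pos_left _ (by omega); assumption
        _ ≤ ((j + 1 + 1) * (j + 1)) * (3 * j !) := Nat.mul_le_mul_right _ this
        _ = _ := by ring

theorem factorial_mul_doubleFactorial_lt {n s : ℕ} (hn : 9 ≤ n) (hs : 4 ≤ s) (hsn : s ≤ n) :
    (n - s)! * s‼ < 3 * (n - 3)! := by
  have base : ∀ n, max 9 s ≤ n → (n - s)! * s‼ < 3 * (n - 3)! := by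
    intro n hn
    induction n, hn using Nat.le_induction with
    | base =>
      rcases Nat.lt_or_ge s 9 with h | h
      · interval_cases s <;> decide
      · rw [max_eq_right h, Nat.sub_self, Nat.factorial_zero, one_mul]
        exact doubleFactorial_lt_three_mul_factorial h
    | succ n hn ih =>
      have h1 : n + 1 - s = (n - s) + 1 := by omega
      have h2 : n + 1 - 3 = (n - 3) + 1 := by omega
      rw [h1, h2, Nat.factorial_succ, Nat.factorial_succ, mul_assoc, mul_left_comm 3]
      exact Nat.mul_lt_mul_of_le_of_lt (by omega) ih (by omega)
  exact base n (by omega)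

theorem altCentralizerCard_singleton_three {n : ℕ} (hn : 5 ≤ n) :
    altCentralizerCard n {3} = 3 * (n - 3)! / 2 := by
  rw [altCentralizerCard, if_neg]
  · simp [centralizerCard, mul_comm]
  · rintro ⟨-, h, -⟩
    simp at h; omega

theorem eq_singleton_three_of_altCentralizerCard_eq_of_le {n : ℕ} (hn : 9 ≤ n) {m : Multiset ℕ}
    (h2 : ∀ a ∈ m, 2 ≤ a) (hs : m.sum ≤ n) (he : Even (m.sum + m.card)) (h0 : m ≠ 0)
    (h : altCentralizerCard n m = altCentralizerCard n {3}) : m = {3} := by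
  have hcard : 2 * m.card ≤ m.sum := by
    have := Multiset.card_nsmul_le_sum h2
    rw [smul_eq_mul] at this
    linarith
  have hcard0 : 0 < m.card := Multiset.card_pos.2 h0
  have h8 : 8 ∣ 3 * (n - 3)! :=
    Dvd.dvd.mul_left ((by decide : 8 ∣ 6 !).trans (Nat.factorial_dvd_factorial (by omega))) 3
  rcases Nat.lt_or_ge m.sum 4 with h4 | h4
  · obtain ⟨a, rfl⟩ := Multiset.card_eq_one.1 (show m.card = 1 by omega)
    simp at h2 h4 he
    interval_cases a
    · exact absurd he (by decide)
    · rfl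
  · exfalso
    have hz : centralizerCard n m < 3 * (n - 3)! :=
      (Nat.mul_le_mul_left _ (prod_mul_prod_count_factorial_le m h2)).trans_lt
        (factorial_mul_doubleFactorial_lt hn h4 hs)
    rw [altCentralizerCard_singleton_three (by omega), altCentralizerCard] at h
    split_ifs at h with hD
    · have hodd : Odd (centralizerCard n m) := by
        obtain ⟨ho, hle, hnd⟩ := hD
        have hf : (n - m.sum)! = 1 := Nat.factorial_eq_one.2 (by omega)
        have hc : ∏ i ∈ m.toFinset, (m.count i)! = 1 := Finset.prod_eq_one fun i _ =>
          Nat.factorial_eq_one.2 (Multiset.nodup_iff_count_le_one.1 hnd i)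
        rw [centralizerCard, hf, hc, one_mul, mul_one]
        clear hf hc hz h hcard hcard0 h4 he h0 hs hle hnd h2
        induction m using Multiset.induction_on with
        | empty => simp
        | cons a m ih =>
          rw [Multiset.prod_cons]
          exact (ho a (Multiset.mem_cons_self a m)).mul
            (ih fun c hc => ho c (Multiset.mem_cons_of_mem hc))
      obtain ⟨k, hk⟩ := hodd
      omega
    · omega

end LargeDegree

section AlternatingGroup

open Equiv Equiv.Perm

variable {n : ℕ}
  {σ : Equiv.Perm {f : alternatingGroup (Fin n) → ℂ // IsIrrChar (alternatingGroup (Fin n)) f}}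
  {τ : Equiv.Perm (ConjClasses (alternatingGroup (Fin n)))}

theorem even_sum_add_card_cycleType (g : alternatingGroup (Fin n)) :
    Even ((g : Perm (Fin n)).cycleType.sum + (g : Perm (Fin n)).cycleType.card) := by
  have h := mem_alternatingGroup.1 g.2
  rw [sign_of_cycleType] at h
  exact (neg_one_pow_eq_one_iff_even (by decide)).1 h

theorem sum_cycleType_le_degree (g : alternatingGroup (Fin n)) :
    (g : Perm (Fin n)).cycleType.sum ≤ n := by
  rw [sum_cycleType]
  exact (Finset.card_le_univ _).trans (Fintype.card_fin n).le

theorem two_le_of_mem_alternatingGroup_cycleType (g : alternatingGroup (Fin n)) :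
    ∀ a ∈ (g : Perm (Fin n)).cycleType, 2 ≤ a :=
  fun _ ha => two_le_of_mem_cycleType ha

theorem IsTableAut.altCentralizerCard_eq (hT : IsTableAut (alternatingGroup (Fin n)) σ τ)
    {g h : alternatingGroup (Fin n)} (hgh : ConjClasses.mk h = τ (ConjClasses.mk g)) :
    altCentralizerCard n (h : Perm (Fin n)).cycleType =
      altCentralizerCard n (g : Perm (Fin n)).cycleType := by
  have := nat_card_centralizer_singleton_eq (g := h) (h := g)
    (by rw [hgh]; exact hT.card_class_eq (ConjClasses.mk g))
  rwa [nat_card_centralizer_alternatingGroup, nat_card_centralizer_alternatingGroup,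
    Fintype.card_fin] at this

theorem IsTableAut.eq_one_iff {G : Type} [Group G] [Fintype G]
    {σ : Equiv.Perm {f : G → ℂ // IsIrrChar G f}} {τ : Equiv.Perm (ConjClasses G)}
    (hT : IsTableAut G σ τ) {g h : G} (hgh : ConjClasses.mk h = τ (ConjClasses.mk g)) :
    g = 1 ↔ h = 1 := by
  constructor
  · rintro rfl
    rw [hT.map_one, ConjClasses.mk_eq_mk_iff_isConj] at hgh
    exact isConj_one_left.1 hgh
  · rintro rfl
    rw [← hT.map_one] at hgh
    exact isConj_one_right.1 (ConjClasses.mk_eq_mk_iff_isConj.1 (τ.injective hgh))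

theorem IsTableAut.isThreeCycle (hn : 7 ≤ n) (hT : IsTableAut (alternatingGroup (Fin n)) σ τ)
    {g h : alternatingGroup (Fin n)} (hgh : ConjClasses.mk h = τ (ConjClasses.mk g))
    (hg : (g : Perm (Fin n)).IsThreeCycle) : (h : Perm (Fin n)).IsThreeCycle := by
  have hc := hT.altCentralizerCard_eq hgh
  rw [show (g : Perm (Fin n)).cycleType = {3} from hg] at hc
  have hs := sum_cycleType_le_degree h
  have he := even_sum_add_card_cycleType h
  have h2 := two_le_of_mem_alternatingGroup_cycleType h
  change (h : Perm (Fin n)).cycleType = {3}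
  rcases Nat.lt_or_ge n 9 with h9 | h9
  · exact eq_singleton_three_of_altCentralizerCard_eq_of_lt n h9 hn _
      (mem_evenCycleTypesUpToEight _ h2 (by omega) he) hs hc
  · refine eq_singleton_three_of_altCentralizerCard_eq_of_le h9 h2 hs he (fun h0 => ?_) hc
    have h1 : h = 1 := Subtype.ext (cycleType_eq_zero.1 h0)
    rw [(hT.eq_one_iff hgh).2 h1] at hg
    simp [IsThreeCycle] at hg

theorem IsTableAut.isThreeCycle_iff (hn : 7 ≤ n) (hT : IsTableAut (alternatingGroup (Fin n)) σ τ)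
    {g h : alternatingGroup (Fin n)} (hgh : ConjClasses.mk h = τ (ConjClasses.mk g)) :
    (h : Perm (Fin n)).IsThreeCycle ↔ (g : Perm (Fin n)).IsThreeCycle :=
  ⟨hT.symm.isThreeCycle hn (τ.eq_symm_apply.2 hgh.symm), hT.isThreeCycle hn hgh⟩

theorem IsTableAut.respectsThreeCycles (hn : 7 ≤ n)
    (hT : IsTableAut (alternatingGroup (Fin n)) σ τ) :
    RespectsThreeCycles fun g h : Perm (Fin n) => ∃ g' h' : alternatingGroup (Fin n),
      (g' : Perm (Fin n)) = g ∧ (h' : Perm (Fin n)) = h ∧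
        ConjClasses.mk h' = τ (ConjClasses.mk g') where
  exists_equiv := by
    rintro _ _ ⟨g, h, rfl, rfl, hgh⟩
    obtain ⟨e, he⟩ := hT.exists_equiv {x | (x : Perm (Fin n)).IsThreeCycle}
      (fun g h hgh => hT.isThreeCycle_iff hn hgh)
      (fun x y => by
        simp only [Set.mem_ofPred_eq, IsThreeCycle, Subgroup.coe_mul, Subgroup.coe_inv,
          cycleType_conj]) hgh
    let φ : {x : alternatingGroup (Fin n) | (x : Perm (Fin n)).IsThreeCycle} ≃
        {t : Perm (Fin n) // t.IsThreeCycle} :=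
      { toFun := fun x => ⟨x.1, x.2⟩
        invFun := fun t => ⟨⟨t.1, t.2.mem_alternatingGroup⟩, t.2⟩
        left_inv := fun _ => rfl
        right_inv := fun _ => rfl }
    exact ⟨φ.symm.trans (e.trans φ), fun t =>
      ⟨g * (φ.symm t).1, h * (e (φ.symm t)).1, rfl, rfl, he (φ.symm t)⟩⟩
  eq_one_iff := by
    rintro _ _ ⟨g, h, rfl, rfl, hgh⟩
    simpa using hT.eq_one_iff hgh
  isThreeCycle_iff := by
    rintro _ _ ⟨g, h, rfl, rfl, hgh⟩
    exact (hT.isThreeCycle_iff hn hgh).symm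
  sign_left := by
    rintro _ _ ⟨g, h, rfl, rfl, hgh⟩
    exact mem_alternatingGroup.1 g.2
  sign_right := by
    rintro _ _ ⟨g, h, rfl, rfl, hgh⟩
    exact mem_alternatingGroup.1 h.2

end AlternatingGroup

theorem table_aut_alternatingGroup_preserves_order (n : ℕ)
    (σ : Equiv.Perm {f : alternatingGroup (Fin n) → ℂ // IsIrrChar (alternatingGroup (Fin n)) f})
    (τ : Equiv.Perm (ConjClasses (alternatingGroup (Fin n))))
    (h : IsTableAut (alternatingGroup (Fin n)) σ τ) :
    ∀ g h' : alternatingGroup (Fin n),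
      ConjClasses.mk h' = τ (ConjClasses.mk g) → orderOf h' = orderOf g := by
  intro g k hgk
  rw [← Subgroup.orderOf_coe k, ← Subgroup.orderOf_coe g]
  rcases Nat.lt_or_ge n 7 with hn | hn
  · have hmem (x : alternatingGroup (Fin n)) :
        (x : Equiv.Perm (Fin n)).cycleType ∈ evenCycleTypesUpToEight :=
      mem_evenCycleTypesUpToEight _ (two_le_of_mem_alternatingGroup_cycleType x)
        (by have := sum_cycleType_le_degree x; omega) (even_sum_add_card_cycleType x)
    rw [← Equiv.Perm.lcm_cycleType, ← Equiv.Perm.lcm_cycleType]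
    refine lcm_eq_of_altCentralizerCard_eq n hn _ (hmem k) _ (hmem g)
      (sum_cycleType_le_degree k) (sum_cycleType_le_degree g) ?_ (h.altCentralizerCard_eq hgk)
    simpa [Equiv.Perm.cycleType_eq_zero] using (h.eq_one_iff hgk).symm
  · exact ((h.respectsThreeCycles hn).orderOf_eq ⟨g, k, rfl, rfl, hgk⟩).symm
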